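/- arXiv:1411.3575 — 2 statements merged into one kernel-verified Lean document; each statement's English description precedes it below -/
import Mathlib

section
/- Let X and Y be nonempty finite sets with |X| ≥ 2, and let K be a channel from X to Y such that for every y ∈ Y there exists x ∈ X with K(y|x) > 0. Define the Dobrushin contraction coefficient ϑ(K) = max_{x,x' ∈ X} ‖K(·|x) − K(·|x')‖_TV, where ‖P − Q‖_TV = (1/2)Σ_y |P(y) − Q(y)|. Then: (i) for every convex Φ : [0,∞) → ℝ and every strictly positive distribution μ on X, η_Φ(μ,K) ≤ ϑ(K), and hence η_Φ(K) ≤ ϑ(K); (ii) for Φ(u) = (1/2)|u−1| (the total variation divergence), η_TV(K) = ϑ(K). -/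
open Finset

noncomputable section

namespace SDPI

variable {X Y : Type} [Fintype X] [Fintype Y]

def IsDist (μ : X → ℝ) : Prop := (∀ x, 0 ≤ μ x) ∧ ∑ x, μ x = 1

def IsPosDist (μ : X → ℝ) : Prop := (∀ x, 0 < μ x) ∧ ∑ x, μ x = 1

def IsChannel (K : X → Y → ℝ) : Prop :=
  (∀ x y, 0 ≤ K x y) ∧ ∀ x, ∑ y, K x y = 1

def push (μ : X → ℝ) (K : X → Y → ℝ) : Y → ℝ := fun y => ∑ x, μ x * K x y

def fDiv (Φ : ℝ → ℝ) (ν μ : X → ℝ) : ℝ := (∑ x, μ x * Φ (ν x / μ x)) - Φ 1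

def eta (Φ : ℝ → ℝ) (μ : X → ℝ) (K : X → Y → ℝ) : ℝ :=
  sSup { r | ∃ ν : X → ℝ, IsDist ν ∧ ν ≠ μ ∧
    r = fDiv Φ (push ν K) (push μ K) / fDiv Φ ν μ }

def etaSup (Φ : ℝ → ℝ) (K : X → Y → ℝ) : ℝ :=
  sSup { r | ∃ μ : X → ℝ, IsPosDist μ ∧ r = eta Φ μ K }

def maxCorr (μ : X → ℝ) (K : X → Y → ℝ) : ℝ :=
  sSup { r | ∃ (f : X → ℝ) (g : Y → ℝ),
    (∑ x, μ x * f x) = 0 ∧ (∑ y, push μ K y * g y) = 0 ∧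
    (∑ x, μ x * (f x) ^ 2) = 1 ∧ (∑ y, push μ K y * (g y) ^ 2) = 1 ∧
    r = ∑ x, ∑ y, μ x * K x y * (f x * g y) }

def adjoint (μ : X → ℝ) (K : X → Y → ℝ) : Y → X → ℝ :=
  fun y x => K x y * μ x / push μ K y

def Ent (Φ : ℝ → ℝ) (μ : X → ℝ) (f : X → ℝ) : ℝ :=
  (∑ x, μ x * Φ (f x)) - Φ (∑ x, μ x * f x)

def Var (μ : X → ℝ) (f : X → ℝ) : ℝ :=
  ∑ x, μ x * (f x - ∑ x', μ x' * f x') ^ 2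

def condExp (μ : X → ℝ) (K : X → Y → ℝ) (f : X → ℝ) : Y → ℝ :=
  fun y => (∑ x, μ x * K x y * f x) / push μ K y

def calE (μ : X → ℝ) (K : X → Y → ℝ) (f g : X → ℝ) : ℝ :=
  ∑ x, ∑ y, μ x * K x y *
    ((f x - condExp μ K f y) * (g x - condExp μ K g y))

def dirichlet (μ : X → ℝ) (M : X → X → ℝ) (f g : X → ℝ) : ℝ :=
  (1 / 2) * ∑ x, ∑ x', μ x * M x x' * ((f x - f x') * (g x - g x'))

def Homogeneous (Φ : ℝ → ℝ) : Prop :=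
  ∃ κ : ℝ → ℝ, (∀ c : ℝ, 0 < c → 0 < κ c) ∧
    ∀ (c : ℝ), 0 < c → ∀ (Z : Type) [Fintype Z], ∀ (μ : Z → ℝ),
      IsDist μ → ∀ f : Z → ℝ, (∀ z, 0 ≤ f z) →
        Ent Φ μ (fun z => c * f z) = κ c * Ent Φ μ f

def Subadditive (Φ : ℝ → ℝ) : Prop :=
  ∀ (n : ℕ) (Z : Fin n → Type) [∀ i, Fintype (Z i)],
    ∀ (μ : ∀ i, Z i → ℝ), (∀ i, IsDist (μ i)) →
    ∀ f : (∀ i, Z i) → ℝ, (∀ z, 0 ≤ f z) →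
      Ent Φ (fun z : ∀ i, Z i => ∏ i, μ i (z i)) f ≤
        ∑ i : Fin n,
          ((∑ z : ∀ j, Z j, (∏ j, μ j (z j)) * Φ (f z)) -
            ∑ z : ∀ j, Z j, (∏ j, μ j (z j)) *
              Φ (∑ w : Z i, μ i w * f (Function.update z i w)))


def tvDist (P Q : Y → ℝ) : ℝ := (∑ y, |P y - Q y|) / 2

def dobrushin (K : X → Y → ℝ) : ℝ :=
  sSup { r | ∃ x x' : X, r = tvDist (K x) (K x') }

lemma tvDist_nonneg (P Q : Y → ℝ) : 0 ≤ tvDist P Q :=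
  div_nonneg (sum_nonneg fun _ _ => abs_nonneg _) (by norm_num)

/-- A convex function agrees on a finite set with a nonnegative combination of hinge functions
`u ↦ max (u - t) 0`, up to an affine function. -/
lemma exists_hinge_decomposition {Φ : ℝ → ℝ} {D : Set ℝ} (hΦ : ConvexOn ℝ D Φ) (S : Finset ℝ) :
    ∀ e, (∀ s ∈ S, s < e) → (∀ s ∈ S, s ∈ D) → e ∈ D →
      ∃ (a b : ℝ) (c : ℝ → ℝ), (∀ t, 0 ≤ c t) ∧
        ∀ u ∈ insert e S, Φ u = a + b * u + ∑ t ∈ S, c t * max (u - t) 0 := by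
  induction S using Finset.induction_on_max with
  | empty =>
    intro e _ _ _
    exact ⟨Φ e, 0, fun _ => 0, fun _ => le_rfl, by simp⟩
  | insert m S hm ih =>
    intro e he hSD heD
    have hme : m < e := he m (mem_insert_self _ _)
    have hmD : m ∈ D := hSD m (mem_insert_self _ _)
    have hmS : m ∉ S := fun h => lt_irrefl _ (hm m h)
    rcases S.eq_empty_or_nonempty with rfl | hS
    · have hne : e - m ≠ 0 := by linarith
      refine ⟨Φ m - (Φ e - Φ m) / (e - m) * m, (Φ e - Φ m) / (e - m), fun _ => 0,
        fun _ => le_rfl, ?_⟩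
      intro u hu
      simp only [insert_empty_eq, mem_insert, mem_singleton] at hu
      rcases hu with rfl | rfl
      · simp
        field_simp
        ring
      · simp
    · obtain ⟨a, b, c, hc, hL⟩ := ih m hm (fun s hs => hSD s (mem_insert_of_mem hs)) hmD
      set s := S.max' hS with hs
      have hsS : s ∈ S := S.max'_mem hS
      have hsm : s < m := hm s hsS
      have htail : ∀ u, s ≤ u →
          ∑ t ∈ S, c t * max (u - t) 0 = (∑ t ∈ S, c t) * u - ∑ t ∈ S, c t * t := by
        intro u hu
        rw [sum_mul, ← sum_sub_distrib]
        refine sum_congr rfl fun t ht => ?_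
        have := S.le_max' t ht
        rw [max_eq_left (by linarith)]
        ring
      have h1 := hL s (mem_insert_of_mem hsS)
      have h2 := hL m (mem_insert_self _ _)
      rw [htail s le_rfl] at h1
      rw [htail m hsm.le] at h2
      have hslope := hΦ.slope_mono_adjacent (hSD s (mem_insert_of_mem hsS)) heD hsm hme
      have hsm' : 0 < m - s := by linarith
      have hme' : 0 < e - m := by linarith
      have hlast : (Φ m - Φ s) / (m - s) = b + ∑ t ∈ S, c t := by
        rw [h1, h2, div_eq_iff hsm'.ne']
        ring
      rw [hlast] at hslope
      refine ⟨a, b, Function.update c m ((Φ e - Φ m) / (e - m) - (b + ∑ t ∈ S, c t)), ?_, ?_⟩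
      · intro t
        by_cases h : t = m
        · subst h
          simpa using hslope
        · simpa [h] using hc t
      · intro u hu
        have hsum : ∑ t ∈ S, Function.update c m ((Φ e - Φ m) / (e - m) - (b + ∑ t ∈ S, c t)) t *
            max (u - t) 0 = ∑ t ∈ S, c t * max (u - t) 0 := by
          refine sum_congr rfl fun t ht => ?_
          rw [Function.update_of_ne (hm t ht).ne]
        rw [sum_insert hmS, hsum, Function.update_self]
        rw [mem_insert] at hu
        rcases hu with rfl | hu
        · rw [max_eq_left hme'.le, htail u (hsm.le.trans hme.le)]
          have : (Φ u - Φ m) / (u - m) * (u - m) = Φ u - Φ m := div_mul_cancel₀ _ hme'.ne'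
          linear_combination h2 - this
        · have hum : u ≤ m := by
            rcases mem_insert.1 hu with rfl | h
            · exact le_rfl
            · exact (hm u h).le
          rw [max_eq_right (by linarith), hL u hu]
          ring

/-- A finite signed measure with vanishing mass and mean that is nonnegative on the functions
`u ↦ |u - t|` is nonnegative on convex functions. -/
lemma sum_convex_nonneg {ι : Type*} [Fintype ι] {Φ : ℝ → ℝ} (hΦ : ConvexOn ℝ (Set.Ici 0) Φ)
    {w p : ι → ℝ} (hp : ∀ i, 0 ≤ p i) (hw : ∑ i, w i = 0) (hwp : ∑ i, w i * p i = 0)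
    (habs : ∀ t, 0 ≤ ∑ i, w i * |p i - t|) : 0 ≤ ∑ i, w i * Φ (p i) := by
  classical
  have hle : ∀ i, p i ≤ ∑ j, p j := fun i =>
    single_le_sum (f := p) (fun j _ => hp j) (mem_univ i)
  have h0 : 0 ≤ ∑ j, p j := sum_nonneg fun j _ => hp j
  obtain ⟨a, b, c, hc, hL⟩ := exists_hinge_decomposition hΦ (univ.image p) (∑ j, p j + 1)
    (by simp only [mem_image, mem_univ, true_and, forall_exists_index, forall_apply_eq_imp_iff]
        intro i; linarith [hle i])
    (by simpa using hp) (by simp only [Set.mem_Ici]; linarith)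
  have hhinge : ∀ t, 0 ≤ ∑ i, w i * max (p i - t) 0 := by
    intro t
    have h : ∑ i, w i * max (p i - t) 0 =
        (∑ i, w i * |p i - t| + ∑ i, w i * p i - (∑ i, w i) * t) / 2 := by
      rw [sum_mul, ← sum_add_distrib, ← sum_sub_distrib, sum_div]
      refine sum_congr rfl fun i _ => ?_
      rcases le_total (p i) t with h | h
      · rw [max_eq_right (by linarith), abs_of_nonpos (by linarith)]
        ring
      · rw [max_eq_left (by linarith), abs_of_nonneg (by linarith)]
        ring
    rw [h, hw, hwp]
    linarith [habs t]
  have hsum : ∑ i, w i * Φ (p i) =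
      ∑ t ∈ univ.image p, c t * ∑ i, w i * max (p i - t) 0 := by
    calc ∑ i, w i * Φ (p i)
        = ∑ i, (w i * a + b * (w i * p i) +
            ∑ t ∈ univ.image p, c t * (w i * max (p i - t) 0)) := by
          refine sum_congr rfl fun i _ => ?_
          rw [hL (p i) (mem_insert_of_mem (mem_image_of_mem _ (mem_univ i))), mul_add, mul_sum]
          congr 1
          · ring
          · exact sum_congr rfl fun t _ => by ring
      _ = _ := by
          rw [sum_add_distrib, sum_add_distrib, ← sum_mul, ← mul_sum, hw, hwp, sum_comm]
          simp [mul_sum]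
  rw [hsum]
  exact sum_nonneg fun t _ => mul_nonneg (hc t) (hhinge t)

lemma tvDist_le_dobrushin (K : X → Y → ℝ) (x x' : X) : tvDist (K x) (K x') ≤ dobrushin K := by
  refine le_csSup ?_ ⟨x, x', rfl⟩
  refine ((Set.finite_range fun q : X × X => tvDist (K q.1) (K q.2)).subset ?_).bddAbove
  rintro r ⟨x, x', rfl⟩
  exact ⟨(x, x'), rfl⟩

lemma dobrushin_nonneg {X : Type} (K : X → Y → ℝ) : 0 ≤ dobrushin K :=
  Real.sSup_nonneg (by rintro r ⟨x, x', rfl⟩; exact tvDist_nonneg _ _)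

lemma sum_push {K : X → Y → ℝ} (hK : IsChannel K) (σ : X → ℝ) : ∑ y, push σ K y = ∑ x, σ x := by
  simp only [push]
  rw [sum_comm]
  exact sum_congr rfl fun x _ => by rw [← mul_sum, hK.2, mul_one]

lemma push_sub {Y : Type} (σ τ : X → ℝ) (K : X → Y → ℝ) (y : Y) :
    push (fun x => σ x - τ x) K y = push σ K y - push τ K y := by
  simp [push, sub_mul]

lemma push_const_mul {Y : Type} (t : ℝ) (σ : X → ℝ) (K : X → Y → ℝ) (y : Y) :
    push (fun x => t * σ x) K y = t * push σ K y := by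
  simp [push, mul_assoc, mul_sum]

/-- Contraction in total variation for the difference of two nonnegative measures. -/
lemma sum_abs_push_sub_le {K : X → Y → ℝ} (hK : IsChannel K) {α β : X → ℝ}
    (hα : ∀ x, 0 ≤ α x) (hβ : ∀ x, 0 ≤ β x) (hle : ∑ x, β x ≤ ∑ x, α x) :
    ∑ y, |push α K y - push β K y| ≤
      2 * dobrushin K * ∑ x, β x + (∑ x, α x - ∑ x, β x) := by
  set P := ∑ x, α x with hP
  set N := ∑ x, β x with hN
  have hN0 : 0 ≤ N := sum_nonneg fun x _ => hβ x
  rcases (hN0.trans hle).eq_or_lt with hP0 | hP0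
  · have hN' : N = 0 := le_antisymm (hP0 ▸ hle) hN0
    have ha : ∀ x, α x = 0 := fun x =>
      (sum_eq_zero_iff_of_nonneg fun x _ => hα x).1 hP0.symm x (mem_univ x)
    have hb : ∀ x, β x = 0 := fun x =>
      (sum_eq_zero_iff_of_nonneg fun x _ => hβ x).1 hN' x (mem_univ x)
    simp [push, ha, hb, hN', ← hP0]
  have hpt : ∀ y, P * |push α K y - push β K y| ≤
      ∑ x, ∑ x', α x * β x' * |K x y - K x' y| + (P - N) * push α K y := by
    intro y
    have hpush : 0 ≤ push α K y := sum_nonneg fun x _ => mul_nonneg (hα x) (hK.1 x y)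
    have hid : P * (push α K y - push β K y) =
        ∑ x, ∑ x', α x * β x' * (K x y - K x' y) + (P - N) * push α K y := by
      have e1 : ∑ x, ∑ x', α x * β x' * (K x y - K x' y) =
          N * push α K y - P * push β K y := by
        simp only [mul_sub, sum_sub_distrib]
        congr 1
        · rw [hN, push, sum_mul_sum, sum_comm]
          exact sum_congr rfl fun _ _ => sum_congr rfl fun _ _ => by ring
        · rw [hP, push, sum_mul_sum]
          exact sum_congr rfl fun _ _ => sum_congr rfl fun _ _ => by ring
      rw [e1]
      ring
    rw [← abs_of_pos hP0, ← abs_mul, abs_of_pos hP0, hid]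
    refine (abs_add_le _ _).trans (add_le_add ?_ ?_)
    · refine (abs_sum_le_sum_abs _ _).trans (sum_le_sum fun x _ => ?_)
      refine (abs_sum_le_sum_abs _ _).trans (sum_le_sum fun x' _ => ?_)
      rw [abs_mul, abs_of_nonneg (mul_nonneg (hα x) (hβ x'))]
    · rw [abs_of_nonneg (mul_nonneg (sub_nonneg.2 hle) hpush)]
  have hpair : ∑ y, ∑ x, ∑ x', α x * β x' * |K x y - K x' y| ≤ 2 * dobrushin K * (P * N) := by
    rw [sum_comm, hP, hN, sum_mul_sum, mul_sum]
    refine sum_le_sum fun x _ => ?_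
    rw [sum_comm, mul_sum]
    refine sum_le_sum fun x' _ => ?_
    rw [← mul_sum]
    have h := tvDist_le_dobrushin K x x'
    rw [tvDist, div_le_iff₀ two_pos] at h
    calc α x * β x' * ∑ y, |K x y - K x' y| ≤ α x * β x' * (dobrushin K * 2) :=
          mul_le_mul_of_nonneg_left h (mul_nonneg (hα x) (hβ x'))
      _ = _ := by ring
  have htot := sum_le_sum fun y (_ : y ∈ univ) => hpt y
  rw [← mul_sum, sum_add_distrib, ← mul_sum, sum_push hK, ← hP] at htot
  refine le_of_mul_le_mul_left ?_ hP0
  calc _ ≤ _ := htot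
    _ ≤ 2 * dobrushin K * (P * N) + (P - N) * P := by gcongr
    _ = _ := by ring

lemma sum_abs_push_le_of_nonneg {K : X → Y → ℝ} (hK : IsChannel K) {σ : X → ℝ}
    (hσ : 0 ≤ ∑ x, σ x) :
    ∑ y, |push σ K y| ≤ dobrushin K * (∑ x, |σ x| - ∑ x, σ x) + ∑ x, σ x := by
  have hdiff : ∀ x, max (σ x) 0 - max (-σ x) 0 = σ x := fun x => max_zero_sub_max_neg_zero_eq_self _
  have hadd : ∀ x, max (σ x) 0 + max (-σ x) 0 = |σ x| := fun x =>
    max_zero_add_max_neg_zero_eq_abs_self _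
  have h1 : ∑ x, max (σ x) 0 - ∑ x, max (-σ x) 0 = ∑ x, σ x := by
    rw [← sum_sub_distrib]
    exact sum_congr rfl fun x _ => hdiff x
  have h2 : ∑ x, max (σ x) 0 + ∑ x, max (-σ x) 0 = ∑ x, |σ x| := by
    rw [← sum_add_distrib]
    exact sum_congr rfl fun x _ => hadd x
  have h := sum_abs_push_sub_le hK (α := fun x => max (σ x) 0) (β := fun x => max (-σ x) 0)
    (fun _ => le_max_right _ _) (fun _ => le_max_right _ _) (by linarith)
  simp only [← push_sub, hdiff, h1] at h
  refine h.trans_eq ?_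
  rw [← h1, ← h2]
  ring

/-- Contraction in total variation for signed measures of arbitrary mass. -/
lemma sum_abs_push_le {K : X → Y → ℝ} (hK : IsChannel K) (σ : X → ℝ) :
    ∑ y, |push σ K y| ≤ dobrushin K * (∑ x, |σ x| - |∑ x, σ x|) + |∑ x, σ x| := by
  rcases le_total 0 (∑ x, σ x) with h | h
  · rw [abs_of_nonneg h]
    exact sum_abs_push_le_of_nonneg hK h
  · have h' := sum_abs_push_le_of_nonneg hK (σ := fun x => -1 * σ x)
      (by rw [← mul_sum]; linarith)
    simp only [push_const_mul, ← mul_sum] at h'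
    simp only [neg_one_mul, abs_neg] at h'
    rwa [abs_of_nonpos h]

lemma IsPosDist.push {K : X → Y → ℝ} (hK : IsChannel K) (hKpos : ∀ y, ∃ x, 0 < K x y)
    {μ : X → ℝ} (hμ : IsPosDist μ) : IsPosDist (push μ K) := by
  refine ⟨fun y => ?_, by rw [sum_push hK, hμ.2]⟩
  obtain ⟨x, hx⟩ := hKpos y
  exact sum_pos' (fun z _ => mul_nonneg (hμ.1 z).le (hK.1 z y))
    ⟨x, mem_univ x, mul_pos (hμ.1 x) hx⟩

lemma IsDist.push {K : X → Y → ℝ} (hK : IsChannel K) {ν : X → ℝ} (hν : IsDist ν) :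
    IsDist (push ν K) :=
  ⟨fun y => sum_nonneg fun x _ => mul_nonneg (hν.1 x) (hK.1 x y), by rw [sum_push hK, hν.2]⟩

lemma IsPosDist.sum_mul_div {μ : X → ℝ} (hμ : IsPosDist μ) (ν : X → ℝ) :
    ∑ x, μ x * (ν x / μ x) = ∑ x, ν x :=
  sum_congr rfl fun x _ => mul_div_cancel₀ _ (hμ.1 x).ne'

lemma IsPosDist.mul_abs_div_sub {μ : X → ℝ} (hμ : IsPosDist μ) (ν : X → ℝ) (t : ℝ) (x : X) :
    μ x * |ν x / μ x - t| = |ν x - t * μ x| := by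
  nth_rewrite 1 [← abs_of_pos (hμ.1 x)]
  rw [← abs_mul, mul_sub, mul_div_cancel₀ _ (hμ.1 x).ne', mul_comm t]

lemma fDiv_nonneg {Φ : ℝ → ℝ} (hΦ : ConvexOn ℝ (Set.Ici 0) Φ) {μ ν : X → ℝ}
    (hμ : IsPosDist μ) (hν : IsDist ν) : 0 ≤ fDiv Φ ν μ := by
  have h := hΦ.map_sum_le (t := univ) (w := μ) (p := fun x => ν x / μ x)
    (fun x _ => (hμ.1 x).le) hμ.2 (fun x _ => div_nonneg (hν.1 x) (hμ.1 x).le)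
  simp only [smul_eq_mul, hμ.sum_mul_div, hν.2] at h
  exact sub_nonneg.2 h

/-- The Dobrushin coefficient bounds the contraction of every `Φ`-divergence. -/
lemma fDiv_push_le {Φ : ℝ → ℝ} (hΦ : ConvexOn ℝ (Set.Ici 0) Φ) {K : X → Y → ℝ}
    (hK : IsChannel K) (hKpos : ∀ y, ∃ x, 0 < K x y) {μ ν : X → ℝ}
    (hμ : IsPosDist μ) (hν : IsDist ν) :
    fDiv Φ (push ν K) (push μ K) ≤ dobrushin K * fDiv Φ ν μ := by
  have hμ' := hμ.push hK hKpos
  have hν' := hν.push hK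
  set θ := dobrushin K
  have h := sum_convex_nonneg hΦ (ι := X ⊕ Y ⊕ Unit)
    (w := Sum.elim (fun x => θ * μ x) (Sum.elim (fun y => -push μ K y) fun _ => 1 - θ))
    (p := Sum.elim (fun x => ν x / μ x) (Sum.elim (fun y => push ν K y / push μ K y) fun _ => 1))
    (by
      rintro (x | y | _)
      · exact div_nonneg (hν.1 x) (hμ.1 x).le
      · exact div_nonneg (hν'.1 y) (hμ'.1 y).le
      · exact zero_le_one)
    (by simp [← mul_sum, hμ.2, hμ'.2]; ring)
    (by simp [mul_assoc, ← mul_sum, hμ.sum_mul_div, hμ'.sum_mul_div, hν.2, hν'.2]; ring)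
    (by
      intro t
      have hc := sum_abs_push_le hK fun x => ν x - t * μ x
      simp only [push_sub, push_const_mul, sum_sub_distrib, ← mul_sum, hν.2, hμ.2, mul_one] at hc
      simp only [Fintype.sum_sum_type, Sum.elim_inl, Sum.elim_inr, mul_assoc, neg_mul, ← mul_sum,
        sum_neg_distrib, hμ.mul_abs_div_sub, hμ'.mul_abs_div_sub, univ_unique, sum_singleton]
      linarith)
  simp only [Fintype.sum_sum_type, Sum.elim_inl, Sum.elim_inr, mul_assoc, neg_mul, ← mul_sum,
    sum_neg_distrib, univ_unique, sum_singleton] at h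
  simp only [fDiv]
  linarith

lemma fDiv_ratio_le {Φ : ℝ → ℝ} (hΦ : ConvexOn ℝ (Set.Ici 0) Φ) {K : X → Y → ℝ}
    (hK : IsChannel K) (hKpos : ∀ y, ∃ x, 0 < K x y) {μ ν : X → ℝ}
    (hμ : IsPosDist μ) (hν : IsDist ν) :
    fDiv Φ (push ν K) (push μ K) / fDiv Φ ν μ ≤ dobrushin K :=
  div_le_of_le_mul₀ (fDiv_nonneg hΦ hμ hν) (dobrushin_nonneg K) (fDiv_push_le hΦ hK hKpos hμ hν)

lemma eta_le_dobrushin {Φ : ℝ → ℝ} (hΦ : ConvexOn ℝ (Set.Ici 0) Φ) {K : X → Y → ℝ}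
    (hK : IsChannel K) (hKpos : ∀ y, ∃ x, 0 < K x y) {μ : X → ℝ} (hμ : IsPosDist μ) :
    eta Φ μ K ≤ dobrushin K :=
  Real.sSup_le (by rintro r ⟨ν, hν, -, rfl⟩; exact fDiv_ratio_le hΦ hK hKpos hμ hν)
    (dobrushin_nonneg K)

lemma etaSup_le_dobrushin {Φ : ℝ → ℝ} (hΦ : ConvexOn ℝ (Set.Ici 0) Φ) {K : X → Y → ℝ}
    (hK : IsChannel K) (hKpos : ∀ y, ∃ x, 0 < K x y) : etaSup Φ K ≤ dobrushin K :=
  Real.sSup_le (by rintro r ⟨μ, hμ, rfl⟩; exact eta_le_dobrushin hΦ hK hKpos hμ)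
    (dobrushin_nonneg K)

lemma fDiv_ratio_le_etaSup {Φ : ℝ → ℝ} (hΦ : ConvexOn ℝ (Set.Ici 0) Φ) {K : X → Y → ℝ}
    (hK : IsChannel K) (hKpos : ∀ y, ∃ x, 0 < K x y) {μ ν : X → ℝ}
    (hμ : IsPosDist μ) (hν : IsDist ν) (hne : ν ≠ μ) :
    fDiv Φ (push ν K) (push μ K) / fDiv Φ ν μ ≤ etaSup Φ K := by
  have h1 : fDiv Φ (push ν K) (push μ K) / fDiv Φ ν μ ≤ eta Φ μ K :=
    le_csSup ⟨dobrushin K, by rintro r ⟨ν', hν', -, rfl⟩; exact fDiv_ratio_le hΦ hK hKpos hμ hν'⟩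
      ⟨ν, hν, hne, rfl⟩
  refine h1.trans (le_csSup ⟨dobrushin K, ?_⟩ ⟨μ, hμ, rfl⟩)
  rintro r ⟨μ', hμ', rfl⟩
  exact eta_le_dobrushin hΦ hK hKpos hμ'

lemma convexOn_abs_sub_one_div_two : ConvexOn ℝ (Set.Ici (0 : ℝ)) fun u => |u - 1| / 2 := by
  refine ⟨convex_Ici 0, fun u _ v _ a b ha hb hab => ?_⟩
  simp only [smul_eq_mul]
  have h : a * u + b * v - 1 = a * (u - 1) + b * (v - 1) := by linear_combination hab
  have h' := abs_add_le (a * (u - 1)) (b * (v - 1))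
  rw [abs_mul, abs_mul, abs_of_nonneg ha, abs_of_nonneg hb] at h'
  rw [h]
  linarith

lemma fDiv_abs {μ : X → ℝ} (hμ : IsPosDist μ) (ν : X → ℝ) :
    fDiv (fun u => |u - 1| / 2) ν μ = (∑ x, |ν x - μ x|) / 2 := by
  simp [fDiv, ← mul_div_assoc, hμ.mul_abs_div_sub, sum_div]

/-- The total variation SDPI constant is at least the distance between any two rows: perturb the
uniform distribution by moving the mass of one symbol onto the other. -/
lemma tvDist_le_etaSup {K : X → Y → ℝ} (hK : IsChannel K) (hKpos : ∀ y, ∃ x, 0 < K x y)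
    {x x' : X} (hxx' : x ≠ x') :
    tvDist (K x) (K x') ≤ etaSup (fun u => |u - 1| / 2) K := by
  classical
  have hn : (0 : ℝ) < Fintype.card X := by exact_mod_cast Fintype.card_pos_iff.2 ⟨x⟩
  set ε : ℝ := (Fintype.card X : ℝ)⁻¹ with hε
  have hε0 : 0 < ε := inv_pos.2 hn
  set d : X → ℝ := fun z => (if z = x then 1 else 0) - if z = x' then 1 else 0 with hd
  set μ : X → ℝ := fun _ => ε with hμdef
  set ν : X → ℝ := fun z => ε + ε * d z with hνdef
  have hdx : d x = 1 := by simp [hd, hxx']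
  have hdx' : d x' = -1 := by simp [hd, hxx'.symm]
  have hd0 : ∀ z, z ≠ x → z ≠ x' → d z = 0 := fun z h h' => by simp [hd, h, h']
  have hsumd : ∑ z, d z = 0 := by simp [hd]
  have habsd : ∑ z, |d z| = 2 := by
    rw [← sum_subset (subset_univ {x, x'}), sum_pair hxx', hdx, hdx']
    · norm_num
    · intro z _ hz
      simp only [mem_insert, mem_singleton, not_or] at hz
      rw [hd0 z hz.1 hz.2, abs_zero]
  have hμ : IsPosDist μ := ⟨fun _ => hε0, by simp [hμdef, hε, hn.ne']⟩
  have hν : IsDist ν := by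
    refine ⟨fun z => ?_, ?_⟩
    · have : -1 ≤ d z := by
        by_cases h : z = x
        · rw [h, hdx]; norm_num
        by_cases h' : z = x'
        · rw [h', hdx']
        rw [hd0 z h h']; norm_num
      have h := mul_le_mul_of_nonneg_left this hε0.le
      simp only [hνdef]
      linarith
    · have h := hμ.2
      simp only [hνdef, sum_add_distrib, ← mul_sum, hsumd, mul_zero, add_zero]
      exact h
  have hdiff : ∀ z, ν z - μ z = ε * d z := fun z => by simp [hνdef, hμdef]
  have hne : ν ≠ μ := by
    intro h
    have := hdiff x
    rw [h, hdx] at this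
    linarith
  have hpush : ∀ y, push ν K y - push μ K y = ε * (K x y - K x' y) := by
    intro y
    rw [← push_sub]
    simp only [hdiff, push_const_mul]
    simp [hd, push, sub_mul]
  have hin : fDiv (fun u => |u - 1| / 2) ν μ = ε := by
    rw [fDiv_abs hμ]
    simp only [hdiff, abs_mul, abs_of_pos hε0, ← mul_sum, habsd]
    ring
  have hout : fDiv (fun u => |u - 1| / 2) (push ν K) (push μ K) =
      ε * tvDist (K x) (K x') := by
    rw [fDiv_abs (hμ.push hK hKpos), tvDist]
    simp only [hpush, abs_mul, abs_of_pos hε0, ← mul_sum]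
    ring
  have h := fDiv_ratio_le_etaSup convexOn_abs_sub_one_div_two hK hKpos hμ hν hne
  rw [hin, hout, mul_div_cancel_left₀ _ hε0.ne'] at h
  exact h

/-- Theorem (Markov contraction bound): for any channel `K` on finite alphabets with
`|X| ≥ 2` such that every output symbol is reachable, (i) for every convex
`Φ : [0,∞) → ℝ` and every strictly positive input distribution `μ`, the SDPI constant
`η_Φ(μ,K)` is at most the Dobrushin contraction coefficient `ϑ(K)`, hence
`η_Φ(K) ≤ ϑ(K)`; and (ii) for the total-variation divergence `Φ(u) = |u-1|/2`,
`η_TV(K) = ϑ(K)`. -/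
theorem statement0 {X Y : Type} [Fintype X] [Fintype Y] [Nonempty X] [Nonempty Y]
    (hX : 2 ≤ Fintype.card X)
    (K : X → Y → ℝ) (hK : IsChannel K) (hKpos : ∀ y : Y, ∃ x : X, 0 < K x y) :
    (∀ Φ : ℝ → ℝ, ConvexOn ℝ (Set.Ici 0) Φ →
        (∀ μ : X → ℝ, IsPosDist μ → eta Φ μ K ≤ dobrushin K) ∧
          etaSup Φ K ≤ dobrushin K) ∧
      etaSup (fun u => |u - 1| / 2) K = dobrushin K := by
  refine ⟨fun Φ hΦ => ⟨fun μ hμ => eta_le_dobrushin hΦ hK hKpos hμ,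
    etaSup_le_dobrushin hΦ hK hKpos⟩, le_antisymm
      (etaSup_le_dobrushin convexOn_abs_sub_one_div_two hK hKpos) ?_⟩
  obtain ⟨x₀, x₁, hne⟩ := Fintype.one_lt_card_iff.1 hX
  have hnonneg := (tvDist_nonneg (K x₀) (K x₁)).trans (tvDist_le_etaSup hK hKpos hne)
  refine Real.sSup_le ?_ hnonneg
  rintro r ⟨x, x', rfl⟩
  by_cases h : x = x'
  · subst h
    simpa [tvDist] using hnonneg
  · exact tvDist_le_etaSup hK hKpos h

end SDPI
end
end

section
/- For every admissible pair (μ,K) on finite alphabets X and Y with |X| ≥ 2, the SDPI constant of the χ²-divergence equals the squared maximal correlation: η_{χ²}(μ,K) = S(μ,K)². -/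
open Finset

noncomputable section

namespace SDPI

variable {X Y : Type} [Fintype X] [Fintype Y]

section ChiSquared

variable {μ : X → ℝ} {K : X → Y → ℝ}

theorem push_mul_condExp {Y : Type} {K : X → Y → ℝ} (hadm : ∀ y, 0 < push μ K y)
    (f : X → ℝ) (y : Y) :
    push μ K y * condExp μ K f y = ∑ x, μ x * K x y * f x :=
  mul_div_cancel₀ _ (hadm y).ne'

theorem sum_push_mul_condExp (hK : IsChannel K) (hadm : ∀ y, 0 < push μ K y) (f : X → ℝ) :
    ∑ y, push μ K y * condExp μ K f y = ∑ x, μ x * f x := by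
  simp only [push_mul_condExp hadm]
  rw [sum_comm]
  refine sum_congr rfl fun x _ => ?_
  rw [← sum_mul, ← mul_sum, hK.2, mul_one]

theorem sum_joint_eq_sum_push (hadm : ∀ y, 0 < push μ K y) (f : X → ℝ) (g : Y → ℝ) :
    ∑ x, ∑ y, μ x * K x y * (f x * g y) = ∑ y, push μ K y * (condExp μ K f y * g y) := by
  rw [sum_comm]
  refine sum_congr rfl fun y _ => ?_
  rw [← mul_assoc, push_mul_condExp hadm, sum_mul]
  exact sum_congr rfl fun x _ => by ring

theorem fDiv_sq_one_add (hμ : ∀ x, 0 < μ x) (f : X → ℝ) :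
    fDiv (fun u => (u - 1) ^ 2) (fun x => μ x * (1 + f x)) μ = ∑ x, μ x * f x ^ 2 := by
  simp only [fDiv, sub_self, ne_eq, OfNat.ofNat_ne_zero, not_false_eq_true, zero_pow, sub_zero]
  refine sum_congr rfl fun x _ => ?_
  rw [mul_div_cancel_left₀ _ (hμ x).ne', add_sub_cancel_left]

theorem push_one_add {Y : Type} {K : X → Y → ℝ} (hadm : ∀ y, 0 < push μ K y)
    (f : X → ℝ) :
    push (fun x => μ x * (1 + f x)) K = fun y => push μ K y * (1 + condExp μ K f y) := by
  funext y
  rw [mul_add, mul_one, push_mul_condExp hadm]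
  simp only [push, ← sum_add_distrib]
  exact sum_congr rfl fun x _ => by ring

theorem condExp_const_mul {Y : Type} {K : X → Y → ℝ} (c : ℝ) (f : X → ℝ) (y : Y) :
    condExp μ K (fun x => c * f x) y = c * condExp μ K f y := by
  simp only [condExp, ← mul_div_assoc, mul_sum]
  congr 1
  exact sum_congr rfl fun x _ => by ring

theorem sum_mul_const_mul_sq {Z : Type} [Fintype Z] (ρ : Z → ℝ) (c : ℝ) (f : Z → ℝ) :
    ∑ z, ρ z * (c * f z) ^ 2 = c ^ 2 * ∑ z, ρ z * f z ^ 2 := by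
  rw [mul_sum]
  exact sum_congr rfl fun z _ => by ring

theorem sum_mul_const_mul {Z : Type} [Fintype Z] (ρ : Z → ℝ) (c : ℝ) (f : Z → ℝ) :
    ∑ z, ρ z * (c * f z) = c * ∑ z, ρ z * f z := by
  rw [mul_sum]
  exact sum_congr rfl fun z _ => by ring

theorem sum_joint_le_one (hμ : IsPosDist μ) (hK : IsChannel K) {f : X → ℝ} {g : Y → ℝ}
    (hf : ∑ x, μ x * f x ^ 2 = 1) (hg : ∑ y, push μ K y * g y ^ 2 = 1) :
    ∑ x, ∑ y, μ x * K x y * (f x * g y) ≤ 1 := by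
  have hf' : ∑ x, ∑ y, μ x * K x y * f x ^ 2 = 1 := by
    rw [← hf]
    refine sum_congr rfl fun x _ => ?_
    rw [← sum_mul, ← mul_sum, hK.2, mul_one]
  have hg' : ∑ x, ∑ y, μ x * K x y * g y ^ 2 = 1 := by
    rw [← hg, sum_comm]
    exact sum_congr rfl fun y _ => by rw [push, sum_mul]
  have h : ∑ x, ∑ y, μ x * K x y * (f x * g y) ≤
      ∑ x, ∑ y, (μ x * K x y * f x ^ 2 + μ x * K x y * g y ^ 2) / 2 := by
    refine sum_le_sum fun x _ => sum_le_sum fun y _ => ?_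
    nlinarith [mul_nonneg (mul_nonneg (hμ.1 x).le (hK.1 x y)) (sq_nonneg (f x - g y))]
  simp only [← sum_div, sum_add_distrib, hf', hg'] at h
  linarith

theorem sum_joint_le_maxCorr (hμ : IsPosDist μ) (hK : IsChannel K) {f : X → ℝ} {g : Y → ℝ}
    (hf0 : ∑ x, μ x * f x = 0) (hg0 : ∑ y, push μ K y * g y = 0)
    (hf : ∑ x, μ x * f x ^ 2 = 1) (hg : ∑ y, push μ K y * g y ^ 2 = 1) :
    ∑ x, ∑ y, μ x * K x y * (f x * g y) ≤ maxCorr μ K := by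
  refine le_csSup ⟨1, ?_⟩ ⟨f, g, hf0, hg0, hf, hg, rfl⟩
  rintro r ⟨f, g, -, -, hf, hg, rfl⟩
  exact sum_joint_le_one hμ hK hf hg

theorem sum_condExp_sq_div_le_maxCorr_sq (hμ : IsPosDist μ) (hK : IsChannel K)
    (hadm : ∀ y, 0 < push μ K y) {h : X → ℝ} (h0 : ∑ x, μ x * h x = 0)
    (hpos : 0 < ∑ x, μ x * h x ^ 2) :
    (∑ y, push μ K y * condExp μ K h y ^ 2) / (∑ x, μ x * h x ^ 2) ≤ maxCorr μ K ^ 2 := by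
  set V := ∑ x, μ x * h x ^ 2
  set A := ∑ y, push μ K y * condExp μ K h y ^ 2 with hA
  have hA0 : 0 ≤ A := sum_nonneg fun y _ => mul_nonneg (hadm y).le (sq_nonneg _)
  rcases hA0.eq_or_lt with hA1 | hA1
  · rw [← hA1, zero_div]
    exact sq_nonneg _
  have hcorr : ∑ x, ∑ y, μ x * K x y * (((√V)⁻¹ * h x) * ((√A)⁻¹ * condExp μ K h y)) =
      √(A / V) := by
    rw [sum_joint_eq_sum_push hadm]
    simp only [condExp_const_mul]
    calc _ = (√V)⁻¹ * (√A)⁻¹ * A := by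
          rw [hA, mul_sum]
          exact sum_congr rfl fun y _ => by ring
      _ = _ := by
          rw [Real.sqrt_div hA0, mul_assoc, inv_mul_eq_div (√A), Real.div_sqrt, inv_mul_eq_div]
  have hle := sum_joint_le_maxCorr (f := fun x => (√V)⁻¹ * h x)
    (g := fun y => (√A)⁻¹ * condExp μ K h y) hμ hK
    (by rw [sum_mul_const_mul, h0, mul_zero])
    (by rw [sum_mul_const_mul, sum_push_mul_condExp hK hadm, h0, mul_zero])
    (by rw [sum_mul_const_mul_sq, inv_pow, Real.sq_sqrt hpos.le, inv_mul_cancel₀ hpos.ne'])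
    (by rw [sum_mul_const_mul_sq, inv_pow, Real.sq_sqrt hA0, inv_mul_cancel₀ hA1.ne'])
  rw [hcorr] at hle
  exact (Real.sqrt_le_left (Real.sqrt_nonneg _ |>.trans hle)).1 hle

theorem fDiv_ratio_le_maxCorr_sq (hμ : IsPosDist μ) (hK : IsChannel K)
    (hadm : ∀ y, 0 < push μ K y) {ν : X → ℝ} (hν : IsDist ν) (hne : ν ≠ μ) :
    fDiv (fun u => (u - 1) ^ 2) (push ν K) (push μ K) / fDiv (fun u => (u - 1) ^ 2) ν μ ≤
      maxCorr μ K ^ 2 := by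
  obtain ⟨h, rfl⟩ : ∃ h : X → ℝ, ν = fun x => μ x * (1 + h x) := by
    refine ⟨fun x => ν x / μ x - 1, funext fun x => ?_⟩
    rw [add_sub_cancel, mul_div_cancel₀ _ (hμ.1 x).ne']
  rw [push_one_add hadm, fDiv_sq_one_add hadm, fDiv_sq_one_add hμ.1]
  refine sum_condExp_sq_div_le_maxCorr_sq hμ hK hadm ?_ ?_
  · have h1 := hν.2
    simp only [mul_add, mul_one, sum_add_distrib, hμ.2] at h1
    linarith
  · obtain ⟨x, hx⟩ := Function.ne_iff.1 hne
    have hx' : h x ≠ 0 := fun h0 => hx (by simp [h0])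
    exact sum_pos' (fun z _ => mul_nonneg (hμ.1 z).le (sq_nonneg _))
      ⟨x, mem_univ _, mul_pos (hμ.1 x) (by positivity)⟩

theorem sum_condExp_sq_le_eta (hμ : IsPosDist μ) (hK : IsChannel K)
    (hadm : ∀ y, 0 < push μ K y) {f : X → ℝ} (hf0 : ∑ x, μ x * f x = 0)
    (hf : ∑ x, μ x * f x ^ 2 = 1) :
    ∑ y, push μ K y * condExp μ K f y ^ 2 ≤ eta (fun u => (u - 1) ^ 2) μ K := by
  refine le_csSup ⟨maxCorr μ K ^ 2, ?_⟩ ?_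
  · rintro r ⟨ν, hν, hne, rfl⟩
    exact fDiv_ratio_le_maxCorr_sq hμ hK hadm hν hne
  have hM : 0 < 1 + ∑ x, |f x| := by positivity
  set ε := (1 + ∑ x, |f x|)⁻¹
  have hε0 : 0 < ε := inv_pos.2 hM
  refine ⟨fun x => μ x * (1 + ε * f x), ⟨fun x => mul_nonneg (hμ.1 x).le ?_, ?_⟩, ?_, ?_⟩
  · have h1 : |f x| ≤ ∑ x, |f x| :=
      single_le_sum (f := fun x => |f x|) (fun z _ => abs_nonneg _) (mem_univ x)
    have h2 : ε * (1 + ∑ x, |f x|) = 1 := inv_mul_cancel₀ hM.ne'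
    nlinarith [neg_abs_le (f x)]
  · simp only [mul_add, mul_one, sum_add_distrib, hμ.2, sum_mul_const_mul, hf0, mul_zero, add_zero]
  · intro heq
    have hz : ∀ x, f x = 0 := fun x => by
      have := congrFun heq x
      have hx := (hμ.1 x).ne'
      simpa [mul_add, hx, hε0.ne'] using this
    simp [hz] at hf
  · rw [push_one_add hadm, fDiv_sq_one_add hadm, fDiv_sq_one_add hμ.1]
    simp only [condExp_const_mul, sum_mul_const_mul_sq, hf, mul_one]
    rw [mul_div_cancel_left₀ _ (pow_pos hε0 2).ne']

theorem sq_sum_joint_le_sum_condExp_sq (hadm : ∀ y, 0 < push μ K y) (f : X → ℝ) {g : Y → ℝ}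
    (hg : ∑ y, push μ K y * g y ^ 2 = 1) :
    (∑ x, ∑ y, μ x * K x y * (f x * g y)) ^ 2 ≤ ∑ y, push μ K y * condExp μ K f y ^ 2 := by
  rw [sum_joint_eq_sum_push hadm]
  have h := sum_sq_le_sum_mul_sum_of_sq_le_mul univ
    (r := fun y => push μ K y * (condExp μ K f y * g y))
    (f := fun y => push μ K y * condExp μ K f y ^ 2) (g := fun y => push μ K y * g y ^ 2)
    (fun y _ => mul_nonneg (hadm y).le (sq_nonneg _))
    (fun y _ => mul_nonneg (hadm y).le (sq_nonneg _)) (fun y _ => le_of_eq (by ring))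
  rwa [hg, mul_one] at h

theorem eta_chiSq_nonneg (hμ : IsPosDist μ) (hadm : ∀ y, 0 < push μ K y) :
    0 ≤ eta (fun u => (u - 1) ^ 2) μ K := by
  refine Real.sSup_nonneg ?_
  rintro r ⟨ν, -, -, rfl⟩
  simp only [fDiv, sub_self, ne_eq, OfNat.ofNat_ne_zero, not_false_eq_true, zero_pow, sub_zero]
  exact div_nonneg (sum_nonneg fun y _ => mul_nonneg (hadm y).le (sq_nonneg _))
    (sum_nonneg fun x _ => mul_nonneg (hμ.1 x).le (sq_nonneg _))

theorem maxCorr_sq_le_eta (hμ : IsPosDist μ) (hK : IsChannel K) (hadm : ∀ y, 0 < push μ K y) :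
    maxCorr μ K ^ 2 ≤ eta (fun u => (u - 1) ^ 2) μ K := by
  have hη := eta_chiSq_nonneg hμ hadm
  have key {f : X → ℝ} {g : Y → ℝ} (hf0 : ∑ x, μ x * f x = 0) (hf : ∑ x, μ x * f x ^ 2 = 1)
      (hg : ∑ y, push μ K y * g y ^ 2 = 1) :
      |∑ x, ∑ y, μ x * K x y * (f x * g y)| ≤ √(eta (fun u => (u - 1) ^ 2) μ K) :=
    Real.abs_le_sqrt <| (sq_sum_joint_le_sum_condExp_sq hadm f hg).trans
      (sum_condExp_sq_le_eta hμ hK hadm hf0 hf)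
  rw [← Real.sq_sqrt hη, sq_le_sq, abs_of_nonneg (Real.sqrt_nonneg _), abs_le]
  constructor
  · by_contra! hlt
    have hneg : maxCorr μ K < 0 := hlt.trans_le (neg_nonpos.2 (Real.sqrt_nonneg _))
    refine hneg.ne (Real.sSup_empty ▸ congrArg sSup (Set.eq_empty_iff_forall_notMem.2 ?_))
    rintro r ⟨f, g, hf0, hg0, hf, hg, rfl⟩
    have h1 := sum_joint_le_maxCorr hμ hK hf0 hg0 hf hg
    have h2 := (abs_le.1 (key hf0 hf hg)).1
    linarith
  · refine Real.sSup_le ?_ (Real.sqrt_nonneg _)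
    rintro r ⟨f, g, hf0, -, hf, hg, rfl⟩
    exact (le_abs_self _).trans (key hf0 hf hg)

theorem eta_le_maxCorr_sq (hμ : IsPosDist μ) (hK : IsChannel K) (hadm : ∀ y, 0 < push μ K y) :
    eta (fun u => (u - 1) ^ 2) μ K ≤ maxCorr μ K ^ 2 := by
  refine Real.sSup_le ?_ (sq_nonneg _)
  rintro r ⟨ν, hν, hne, rfl⟩
  exact fDiv_ratio_le_maxCorr_sq hμ hK hadm hν hne

end ChiSquared

/-- Theorem: for every admissible pair `(μ,K)` on finite alphabets with `|X| ≥ 2`,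
the SDPI constant of the χ²-divergence (Φ(u) = (u-1)²) equals the squared maximal
correlation: `η_{χ²}(μ,K) = S(μ,K)²`. -/
theorem statement1 {X Y : Type} [Fintype X] [Fintype Y] [Nonempty X] [Nonempty Y]
    (hX : 2 ≤ Fintype.card X)
    (μ : X → ℝ) (K : X → Y → ℝ) (hμ : IsPosDist μ) (hK : IsChannel K)
    (hadm : ∀ y, 0 < push μ K y) :
    eta (fun u => (u - 1) ^ 2) μ K = (maxCorr μ K) ^ 2 :=
  (eta_le_maxCorr_sq hμ hK hadm).antisymm (maxCorr_sq_le_eta hμ hK hadm)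

end SDPI
end
end
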